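/- Let S be a set of integers with only finitely many negative elements, positive lower asymptotic density α, and suppose S is an asymptotic basis for N (some h-fold sumset hS contains all sufficiently large natural numbers). Then the order G(S) of S satisfies G(S) ≤ 4/α. -/

import Mathlib

open Filter Set Pointwise

/-- `nfold A h` is the `h`-fold sumset of `A` (sums of exactly `h` elements). -/
def nfold (A : Set ℤ) : ℕ → Set ℤ
  | 0 => {0}
  | n + 1 => A + nfold A n

/-- The `h`-fold sumset of `A` contains all sufficiently large naturals. -/
def CoversAt (A : Set ℤ) (h : ℕ) : Prop :=
  ∀ᶠ m : ℕ in Filter.atTop, (m : ℤ) ∈ nfold A h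

/-- `A` is an asymptotic basis for ℕ. -/
def IsAsympBasis (A : Set ℤ) : Prop := ∃ h, CoversAt A h

/-- The order `G(A)` of an asymptotic basis. -/
noncomputable def basisOrder (A : Set ℤ) : ℕ := sInf {h | CoversAt A h}

/-- Lower asymptotic density of a set of integers. -/
noncomputable def lowerDensity (S : Set ℤ) : ℝ :=
  Filter.liminf (fun n : ℕ => ((S ∩ Set.Icc 1 (n : ℤ)).ncard : ℝ) / n) Filter.atTop

/-- Diameter of a set of integers. -/
noncomputable def diam (S : Set ℤ) : ℤ := sSup S - sInf S

/-- `h`-fold sumset in `ZMod n`. -/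
def nfoldZ {n : ℕ} (A : Set (ZMod n)) : ℕ → Set (ZMod n)
  | 0 => {0}
  | t + 1 => A + nfoldZ A t

section FiniteGroup

variable {G : Type*} [AddCommGroup G] [Fintype G] [DecidableEq G]

/-- In a finite abelian group, an atom of `A` (a set minimizing first the boundary
`#(X + A) - #X` among the sets with `X + A` not everything, and then the cardinality) that meets
a translate of itself coincides with it. -/
theorem atom_vadd_eq {A M : Finset G} {κ : ℕ}
    (hκ : ∀ X : Finset G, X.Nonempty → X + A ≠ Finset.univ → X.card + κ ≤ (X + A).card)
    (hM : M.Nonempty) (hMA : M + A ≠ Finset.univ) (hMκ : (M + A).card = M.card + κ)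
    (hmin : ∀ X : Finset G, X.Nonempty → X + A ≠ Finset.univ → (X + A).card = X.card + κ →
      M.card ≤ X.card)
    (g : G) (hg : ((g +ᵥ M) ∩ M).Nonempty) : g +ᵥ M = M := by
  classical
  have hdual : M.card ≤ Fintype.card G - (M + A).card := by
    set Y : Finset G := -(M + A)ᶜ with hY
    have hYcard : Y.card = Fintype.card G - (M + A).card := by
      rw [hY, Finset.card_neg, Finset.card_compl]
    have hYne : Y.Nonempty := by
      rw [hY, Finset.neg_nonempty_iff, Finset.nonempty_iff_ne_empty]
      simpa [Finset.compl_eq_empty_iff] using hMA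
    have hsub : Y + A ⊆ -Mᶜ := by
      intro z hz
      obtain ⟨y, hy, a, ha, rfl⟩ := Finset.mem_add.1 hz
      rw [hY, Finset.mem_neg'] at hy
      rw [Finset.mem_neg', Finset.mem_compl]
      intro hcon
      refine Finset.mem_compl.1 hy (Finset.mem_add.2 ⟨_, hcon, a, ha, by abel⟩)
    have hcard : (Y + A).card ≤ Fintype.card G - M.card := by
      simpa [Finset.card_compl] using Finset.card_le_card hsub
    have hMpos := hM.card_pos
    have hle : (M + A).card ≤ Fintype.card G := Finset.card_le_univ _
    have hYA : Y + A ≠ Finset.univ := by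
      intro h
      rw [h, Finset.card_univ] at hcard
      omega
    have h1 := hκ Y hYne hYA
    rw [← hYcard]
    exact hmin Y hYne hYA (by omega)
  set N := g +ᵥ M with hN
  have hNcard : N.card = M.card := Finset.card_vadd_finset _ _
  have hNA : (N + A).card = M.card + κ := by
    rw [hN, vadd_add_assoc, Finset.card_vadd_finset, hMκ]
  by_contra hne
  have hlt : (N ∩ M).card < M.card := by
    refine Finset.card_lt_card (Finset.ssubset_iff_subset_ne.2 ⟨Finset.inter_subset_right, ?_⟩)
    intro h
    have : M ⊆ N := by rw [← h]; exact Finset.inter_subset_left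
    exact hne (Finset.eq_of_subset_of_card_le this hNcard.le).symm
  have hIA : (N ∩ M) + A ≠ Finset.univ := by
    intro h
    apply hMA
    rw [Finset.eq_univ_iff_forall] at h ⊢
    exact fun x => Finset.add_subset_add_right Finset.inter_subset_right (h x)
  have hI := hκ _ hg hIA
  have hI' : (N ∩ M).card + κ ≠ ((N ∩ M) + A).card := fun h => by
    have := hmin _ hg hIA h.symm
    omega
  have hsubm : ((N ∩ M) + A).card + ((N ∪ M) + A).card ≤ (N + A).card + (M + A).card := by
    rw [Finset.union_add, ← Finset.card_union_add_card_inter (N + A) (M + A), add_comm]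
    exact Nat.add_le_add_left (Finset.card_le_card (Finset.inter_add_subset)) _
  have hUcard := Finset.card_union_add_card_inter N M
  have hle : (M + A).card ≤ Fintype.card G := Finset.card_le_univ _
  have hUA : (N ∪ M) + A ≠ Finset.univ := by
    intro h
    rw [h, Finset.card_univ] at hsubm
    omega
  have hU := hκ _ (hM.mono Finset.subset_union_right) hUA
  omega

/-- Olson's theorem in a finite abelian group: if `A` contains `0` and generates, then
`X + A` is everything or has at least `#X + #A / 2` elements. -/
theorem two_mul_card_add_card_le {A : Finset G} (h0 : (0 : G) ∈ A)
    (hgen : AddSubgroup.closure (A : Set G) = ⊤) {X : Finset G} (hX : X.Nonempty)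
    (hXA : X + A ≠ Finset.univ) : 2 * X.card + A.card ≤ 2 * (X + A).card := by
  classical
  obtain ⟨Z, hZ, hZmin⟩ := Finset.exists_min_image
    (Finset.univ.filter fun Y : Finset G => Y.Nonempty ∧ Y + A ≠ Finset.univ)
    (fun Y => (Y + A).card - Y.card) ⟨X, by simp [hX, hXA]⟩
  set κ := (Z + A).card - Z.card with hκdef
  have hle : ∀ Y : Finset G, Y.card ≤ (Y + A).card := fun Y =>
    Finset.card_le_card (Finset.subset_add_left Y h0)
  have hκ : ∀ Y : Finset G, Y.Nonempty → Y + A ≠ Finset.univ → Y.card + κ ≤ (Y + A).card := by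
    intro Y hY hYA
    have := hZmin Y (by simp [hY, hYA])
    have := hle Y
    omega
  simp only [Finset.mem_filter, Finset.mem_univ, true_and] at hZ
  obtain ⟨M, hM, hMmin⟩ := Finset.exists_min_image
    (Finset.univ.filter fun Y : Finset G =>
      Y.Nonempty ∧ Y + A ≠ Finset.univ ∧ (Y + A).card = Y.card + κ)
    Finset.card ⟨Z, by
      have := hle Z
      simp only [Finset.mem_filter, Finset.mem_univ, true_and]
      exact ⟨hZ.1, hZ.2, by omega⟩⟩
  simp only [Finset.mem_filter, Finset.mem_univ, true_and] at hM hMmin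
  obtain ⟨hMne, hMA, hMκ⟩ := hM
  have hstab := atom_vadd_eq hκ hMne hMA hMκ fun Y h1 h2 h3 => hMmin Y ⟨h1, h2, h3⟩
  obtain ⟨x, hx⟩ := hMne
  have hper : ∀ y ∈ M, ∀ z ∈ M, (z - y) +ᵥ M = M := fun y hy z hz =>
    hstab _ ⟨z, Finset.mem_inter.2 ⟨Finset.mem_vadd_finset.2 ⟨y, hy, by simp⟩, hz⟩⟩
  let F : AddSubgroup G := AddAction.stabilizer G M
  have hFM : ∀ f ∈ F, f + x ∈ M := fun f hf => by
    have hf' : f +ᵥ M = M := hf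
    rw [← hf']
    exact Finset.mem_vadd_finset.2 ⟨x, hx, rfl⟩
  have hAF : ¬ (A : Set G) ⊆ F := by
    intro hsub
    have htop : F = ⊤ := top_le_iff.1 (hgen ▸ (AddSubgroup.closure_le F).2 hsub)
    apply hMA
    rw [Finset.eq_univ_iff_forall]
    intro z
    refine Finset.mem_add.2 ⟨z, ?_, 0, h0, add_zero z⟩
    simpa using hFM (z - x) (htop ▸ AddSubgroup.mem_top _)
  obtain ⟨a, ha, haF⟩ := Set.not_subset.1 hAF
  have hdisj : Disjoint M (a +ᵥ M) := by
    rw [Finset.disjoint_left]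
    intro z hz hz'
    exact haF (hstab a ⟨z, Finset.mem_inter.2 ⟨hz', hz⟩⟩)
  have htwo : 2 * M.card ≤ (M + A).card := by
    have hsub : M ∪ (a +ᵥ M) ⊆ M + A := by
      refine Finset.union_subset (Finset.subset_add_left M h0) ?_
      intro z hz
      obtain ⟨y, hy, rfl⟩ := Finset.mem_vadd_finset.1 hz
      exact Finset.mem_add.2 ⟨y, hy, a, ha, by simp [add_comm]⟩
    have := Finset.card_le_card hsub
    rw [Finset.card_union_of_disjoint hdisj, Finset.card_vadd_finset] at this
    omega
  have hAle : A.card ≤ (M + A).card :=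
    (Finset.card_vadd_finset x A).symm.le.trans
      (Finset.card_le_card fun z hz => by
        obtain ⟨y, hy, rfl⟩ := Finset.mem_vadd_finset.1 hz
        exact Finset.mem_add.2 ⟨x, hx, y, hy, rfl⟩)
  have := hκ X hX hXA
  omega

/-- A generating set of a finite abelian group containing `0` has `h`-fold sumset everything
once `2 * #G ≤ (h + 1) * #A`. -/
theorem nsmul_eq_univ_of_card_le {A : Finset G} (h0 : (0 : G) ∈ A)
    (hgen : AddSubgroup.closure (A : Set G) = ⊤) {h : ℕ} (hh : 1 ≤ h)
    (hcard : 2 * Fintype.card G ≤ (h + 1) * A.card) : h • A = Finset.univ := by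
  have key : ∀ k : ℕ, 1 ≤ k → k • A = Finset.univ ∨ (k + 1) * A.card ≤ 2 * (k • A).card := by
    intro k hk
    induction k, hk using Nat.le_induction with
    | base => right; simp
    | succ k hk ih =>
      by_cases hU : (k + 1) • A = Finset.univ
      · exact Or.inl hU
      right
      rw [succ_nsmul] at hU ⊢
      have hne : (k • A).Nonempty := Finset.Nonempty.nsmul ⟨0, h0⟩
      have h1 := two_mul_card_add_card_le h0 hgen hne hU
      rcases ih with ih | ih
      · exact absurd (Finset.eq_univ_iff_forall.2 fun z =>
          Finset.subset_add_left (k • A) h0 (ih ▸ Finset.mem_univ z)) hU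
      · nlinarith
  rcases key h hh with h1 | h1
  · exact h1
  · refine (Finset.card_eq_iff_eq_univ _).1 (le_antisymm (Finset.card_le_univ _) ?_)
    omega

end FiniteGroup

section Nfold

theorem coversAt_iff {A : Set ℤ} {h : ℕ} :
    CoversAt A h ↔ ∃ N : ℤ, ∀ m : ℤ, N ≤ m → m ∈ nfold A h := by
  rw [CoversAt, eventually_atTop]
  constructor
  · rintro ⟨N, hN⟩
    refine ⟨N, fun m hm => ?_⟩
    lift m to ℕ using by omega
    exact hN m (by exact_mod_cast hm)
  · rintro ⟨N, hN⟩
    exact ⟨N.toNat, fun m hm => hN m (by omega)⟩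

theorem nfold_add_mem {A : Set ℤ} {x y : ℤ} {a b : ℕ} (hx : x ∈ nfold A a)
    (hy : y ∈ nfold A b) : x + y ∈ nfold A (a + b) := by
  induction a generalizing x with
  | zero =>
    have : x = 0 := hx
    simpa [this] using hy
  | succ a ih =>
    obtain ⟨s, hs, t, ht, rfl⟩ := Set.mem_add.1 hx
    rw [Nat.succ_add, add_assoc]
    exact Set.add_mem_add hs (ih ht)

theorem mul_mem_nfold {A : Set ℤ} {x : ℤ} (hx : x ∈ A) (a : ℕ) : (a : ℤ) * x ∈ nfold A a := by
  induction a with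
  | zero => simp [nfold]
  | succ a ih =>
    have : ((a + 1 : ℕ) : ℤ) * x = x + a * x := by push_cast; ring
    rw [this]
    exact Set.add_mem_add hx ih

theorem nfold_mono {A : Set ℤ} (h0 : (0 : ℤ) ∈ A) {a b : ℕ} (hab : a ≤ b) :
    nfold A a ⊆ nfold A b := by
  intro x hx
  have := nfold_add_mem hx (mul_mem_nfold h0 (b - a))
  rwa [mul_zero, add_zero, Nat.add_sub_cancel' hab] at this

theorem nonneg_of_mem_nfold {A : Set ℤ} (hA : ∀ x ∈ A, 0 ≤ x) {a : ℕ} {x : ℤ}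
    (hx : x ∈ nfold A a) : 0 ≤ x := by
  induction a generalizing x with
  | zero => exact (show x = 0 from hx).ge
  | succ a ih =>
    obtain ⟨s, hs, t, ht, rfl⟩ := Set.mem_add.1 hx
    exact add_nonneg (hA s hs) (ih ht)

theorem add_mul_mem_nfold_of_mem_nfold {A B : Set ℤ} {c : ℤ} (h : ∀ x ∈ A, x + c ∈ B) {a : ℕ}
    {x : ℤ} (hx : x ∈ nfold A a) : x + a * c ∈ nfold B a := by
  induction a generalizing x with
  | zero => simp [nfold, show x = 0 from hx]
  | succ a ih =>
    obtain ⟨s, hs, t, ht, rfl⟩ := Set.mem_add.1 hx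
    have : s + t + ((a + 1 : ℕ) : ℤ) * c = (s + c) + (t + a * c) := by push_cast; ring
    rw [this]
    exact Set.add_mem_add (h s hs) (ih ht)

theorem CoversAt.translate {A B : Set ℤ} {c : ℤ} (h : ∀ x ∈ A, x + c ∈ B) {a : ℕ}
    (hA : CoversAt A a) : CoversAt B a := by
  rw [coversAt_iff] at hA ⊢
  obtain ⟨N, hN⟩ := hA
  refine ⟨N + a * c, fun m hm => ?_⟩
  simpa using add_mul_mem_nfold_of_mem_nfold h (hN (m - a * c) (by linarith))

/-- The residues modulo `l` of the elements of `S` in `[1, l]`. -/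
noncomputable def residues (S : Set ℤ) (l : ℕ) : Finset (ZMod l) :=
  open Classical in ((Finset.Icc (1 : ℤ) l).filter (· ∈ S)).image (Int.cast : ℤ → ZMod l)

theorem mem_residues {S : Set ℤ} {l : ℕ} {x : ZMod l} :
    x ∈ residues S l ↔ ∃ s ∈ S, 1 ≤ s ∧ s ≤ l ∧ (s : ZMod l) = x := by
  simp only [residues, Finset.mem_image, Finset.mem_filter, Finset.mem_Icc]
  exact ⟨fun ⟨s, ⟨⟨h1, h2⟩, h3⟩, h4⟩ => ⟨s, h3, h1, h2, h4⟩,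
    fun ⟨s, h3, h1, h2, h4⟩ => ⟨s, ⟨⟨h1, h2⟩, h3⟩, h4⟩⟩

theorem card_residues (S : Set ℤ) (l : ℕ) :
    (residues S l).card = (S ∩ Set.Icc 1 (l : ℤ)).ncard := by
  classical
  rw [residues, Finset.card_image_of_injOn, ← Set.ncard_coe_finset]
  · congr 1
    ext x
    simp only [Finset.coe_filter, Finset.mem_Icc, Set.mem_ofPred_eq, Set.mem_inter_iff,
      Set.mem_Icc, and_comm]
  · intro x hx y hy hxy
    simp only [Finset.coe_filter, Finset.mem_Icc, Set.mem_ofPred_eq] at hx hy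
    have hdvd := (ZMod.intCast_eq_intCast_iff_dvd_sub x y l).1 hxy
    have := Int.eq_zero_of_abs_lt_dvd hdvd (by rw [abs_lt]; omega)
    omega

theorem closure_residues_eq_top {S : Set ℤ} (hS : ∀ x ∈ S, 0 ≤ x) {l h : ℕ} {y : ℤ}
    (hy : y ∈ nfold S h) (hy' : y + 1 ∈ nfold S h) (hyl : y + 1 ≤ l) :
    AddSubgroup.closure (residues S l : Set (ZMod l)) = ⊤ := by
  have key : ∀ (a : ℕ) (z : ℤ), z ∈ nfold S a → z ≤ l →
      (z : ZMod l) ∈ AddSubgroup.closure (residues S l : Set (ZMod l)) := by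
    intro a
    induction a with
    | zero =>
      intro z hz _
      rw [show z = 0 from hz, Int.cast_zero]
      exact zero_mem _
    | succ a ih =>
      intro z hz hzl
      obtain ⟨s, hs, t, ht, rfl⟩ := Set.mem_add.1 hz
      have hs0 := hS s hs
      have ht0 := nonneg_of_mem_nfold hS ht
      rw [Int.cast_add]
      refine add_mem ?_ (ih t ht (by omega))
      rcases hs0.eq_or_lt with rfl | hpos
      · rw [Int.cast_zero]
        exact zero_mem _
      · exact AddSubgroup.subset_closure
          (Finset.mem_coe.2 (mem_residues.2 ⟨s, hs, hpos, by omega, rfl⟩))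
  have h1 := sub_mem (key h _ hy' hyl) (key h _ hy (by omega))
  rw [Int.cast_add, add_sub_cancel_left, Int.cast_one] at h1
  refine (AddSubgroup.eq_top_iff' _).2 fun z => ?_
  obtain ⟨n, rfl⟩ := ZMod.intCast_surjective z
  simpa using zsmul_mem h1 n

theorem exists_mem_nfold_of_mem_nsmul_residues {S : Set ℤ} {l a : ℕ} {x : ZMod l}
    (hx : x ∈ a • residues S l) : ∃ y ∈ nfold S a, 0 ≤ y ∧ y ≤ a * l ∧ (y : ZMod l) = x := by
  induction a generalizing x with
  | zero =>
    rw [zero_nsmul, Finset.mem_zero] at hx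
    exact ⟨0, rfl, le_rfl, by simp, by simp [hx]⟩
  | succ a ih =>
    rw [succ_nsmul'] at hx
    obtain ⟨u, hu, v, hv, rfl⟩ := Finset.mem_add.1 hx
    obtain ⟨s, hs, hs1, hsl, rfl⟩ := mem_residues.1 hu
    obtain ⟨y, hy, hy0, hyl, rfl⟩ := ih hv
    refine ⟨s + y, Set.add_mem_add hs hy, by omega, ?_, by push_cast; rfl⟩
    push_cast
    linarith

/-- If the `r`-fold sumset of `S ∩ [1, l]` covers all residues modulo `l ∈ S`, then it covers
long intervals after adding further copies of `l`. -/
theorem mem_nfold_of_nsmul_residues {S : Set ℤ} (h0 : (0 : ℤ) ∈ S) {l r t : ℕ} (hl : (l : ℤ) ∈ S)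
    (hl0 : 0 < l) (hr : ∀ x : ZMod l, x ∈ r • residues S l) {m : ℤ} (hm : (r : ℤ) * l ≤ m)
    (hm' : m < (t + 1) * l) : m ∈ nfold S (r + t) := by
  obtain ⟨y, hy, hy0, hyl, hym⟩ := exists_mem_nfold_of_mem_nsmul_residues (hr m)
  obtain ⟨j, hj⟩ := (ZMod.intCast_eq_intCast_iff_dvd_sub y m l).1 hym
  have hl0' : (0 : ℤ) < l := by exact_mod_cast hl0
  have hj0 : 0 ≤ j := by
    by_contra hneg
    nlinarith
  have hjt : j ≤ t := by
    by_contra hgt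
    have : (t : ℤ) + 1 ≤ j := by omega
    nlinarith
  lift j to ℕ using hj0
  have := nfold_add_mem hy (nfold_mono h0 (by exact_mod_cast hjt) (mul_mem_nfold hl j))
  rwa [mul_comm, ← hj, add_sub_cancel] at this

/-- Covering the gap between two consecutive scales `l < l'` by using copies of both. -/
theorem mem_nfold_of_scales {S : Set ℤ} (h0 : (0 : ℤ) ∈ S) {l r K : ℕ} {l' : ℤ}
    (hl : (l : ℤ) ∈ S) (hl0 : 0 < l) (hl' : l' ∈ S) (hll' : (l : ℤ) < l')
    (hr : ∀ x : ZMod l, x ∈ r • residues S l) (hr1 : 1 ≤ r) (hrK : r ≤ K)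
    (hgap : (r : ℤ) * l' ≤ (K + 1) * l) {m : ℤ} (hm : (K : ℤ) * l ≤ m) (hm' : m < K * l') :
    m ∈ nfold S (2 * K) := by
  have hl0' : (0 : ℤ) < l := by exact_mod_cast hl0
  have hl'0 : 0 < l' := by omega
  obtain ⟨d, rfl⟩ := Nat.exists_eq_add_of_le hrK
  have hrm : 0 ≤ m - r * l := by
    push_cast at hm
    nlinarith [mul_nonneg (Int.natCast_nonneg d) hl0'.le]
  suffices h : ∃ i : ℕ, i ≤ d ∧ (r : ℤ) * l ≤ m - i * l' ∧
      m - i * l' < ((r + 2 * d - i : ℕ) + 1) * l by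
    obtain ⟨i, hid, h1, h2⟩ := h
    have := nfold_add_mem (mem_nfold_of_nsmul_residues h0 hl hl0 hr h1 h2) (mul_mem_nfold hl' i)
    rw [sub_add_cancel] at this
    convert this using 2
    omega
  obtain ⟨q, hq⟩ := Int.eq_ofNat_of_zero_le (Int.ediv_nonneg hrm hl'0.le)
  have hq1 : q * l' ≤ m - r * l := hq ▸ Int.ediv_mul_le _ hl'0.ne'
  have hq2 : m - r * l < (q + 1) * l' := hq ▸ Int.lt_ediv_add_one_mul_self _ hl'0
  push_cast at hgap hm'
  by_cases hqd : q < d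
  · refine ⟨q, hqd.le, by linarith, ?_⟩
    have hlin : l' ≤ (d + 2) * l := by
      have : (r : ℤ) * l' ≤ r * ((d + 2) * l) := by
        refine hgap.trans ?_
        rw [← mul_assoc]
        refine mul_le_mul_of_nonneg_right ?_ hl0'.le
        have : (1 : ℤ) ≤ r := by exact_mod_cast hr1
        nlinarith [mul_nonneg (Int.natCast_nonneg d) (sub_nonneg.2 this)]
      exact le_of_mul_le_mul_left this (by exact_mod_cast hr1)
    have hc : ((r + 2 * d - q : ℕ) : ℤ) = r + 2 * d - q := by omega
    have hqd' : (q : ℤ) + 1 ≤ d := by exact_mod_cast hqd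
    rw [hc]
    nlinarith [mul_nonneg (sub_nonneg.2 hqd') hl0'.le]
  · have hqd' : (d : ℤ) ≤ q := by exact_mod_cast not_lt.1 hqd
    have hc : ((r + 2 * d - d : ℕ) : ℤ) = r + d := by omega
    refine ⟨d, le_rfl, by nlinarith, ?_⟩
    rw [hc]
    nlinarith

end Nfold

/-- A set of naturals containing `0` that is an asymptotic basis and whose counting function is
eventually at least `β n` has order at most `2 * K` as soon as `2 / β < K + 1`. -/
theorem coversAt_two_mul {S : Set ℤ} (h0 : (0 : ℤ) ∈ S) (hS : ∀ x ∈ S, 0 ≤ x)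
    (hbasis : IsAsympBasis S) {β : ℝ} (hβ : 0 < β) {K : ℕ} (hK : 2 < β * (K + 1))
    (hcount : ∀ᶠ n : ℕ in atTop, β * n ≤ (S ∩ Set.Icc 1 (n : ℤ)).ncard) :
    CoversAt S (2 * K) := by
  obtain ⟨h, hh⟩ := hbasis
  obtain ⟨N₁, hN₁⟩ := coversAt_iff.1 hh
  obtain ⟨N₀, hN₀⟩ := eventually_atTop.1 hcount
  have hub : ∀ N : ℤ, ∃ s ∈ S, N < s := by
    intro N
    by_contra! hcon
    obtain ⟨n, hn⟩ := exists_nat_gt ((N.toNat : ℝ) / β)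
    have hn' : N.toNat < β * (max n N₀ : ℕ) := by
      rw [div_lt_iff₀ hβ] at hn
      have : (n : ℝ) ≤ (max n N₀ : ℕ) := by exact_mod_cast le_max_left _ _
      nlinarith
    have h1 := hN₀ (max n N₀) (le_max_right _ _)
    have h2 : (S ∩ Set.Icc 1 ((max n N₀ : ℕ) : ℤ)).ncard ≤ N.toNat := by
      have := Set.ncard_le_ncard (s := S ∩ Set.Icc 1 ((max n N₀ : ℕ) : ℤ)) (t := Set.Icc 1 N)
        (fun x hx => ⟨hx.2.1, hcon x hx.1⟩) (Set.finite_Icc _ _)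
      rw [← Finset.coe_Icc 1 N, Set.ncard_coe_finset, Int.card_Icc] at this
      simpa using this
    have h2' : ((S ∩ Set.Icc 1 ((max n N₀ : ℕ) : ℤ)).ncard : ℝ) ≤ N.toNat := by exact_mod_cast h2
    linarith
  have hK0 : 0 < K := by
    rcases Nat.eq_zero_or_pos K with rfl | hpos
    · have h1 := hN₀ (N₀ + 1) (by omega)
      have h2 : (residues S (N₀ + 1)).card ≤ N₀ + 1 :=
        (Finset.card_le_univ _).trans (ZMod.card _).le
      rw [card_residues] at h2
      have h3 : ((S ∩ Set.Icc 1 ((N₀ + 1 : ℕ) : ℤ)).ncard : ℝ) ≤ (N₀ + 1 : ℕ) := by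
        exact_mod_cast h2
      have h4 : (0 : ℝ) < (N₀ + 1 : ℕ) := by positivity
      push_cast at hK
      nlinarith
    · exact hpos
  obtain ⟨C, hC⟩ := exists_nat_gt (2 / (β * (K + 1) - 2))
  obtain ⟨s₀, hs₀, hs₀L⟩ := hub (max (max (N₀ : ℤ) (max N₁ 0 + 1)) C)
  refine coversAt_iff.2 ⟨K * s₀, fun m hm => ?_⟩
  have hK0' : (0 : ℤ) < K := by exact_mod_cast hK0
  obtain ⟨l, ⟨hlS, hlm⟩, hlmax⟩ := Int.exists_greatest_of_bdd (P := fun z => z ∈ S ∧ K * z ≤ m)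
    ⟨m, fun z hz => by nlinarith [hS z hz.1]⟩ ⟨s₀, hs₀, hm⟩
  obtain ⟨l', ⟨hlS', hlm'⟩, hlmin⟩ := Int.exists_least_of_bdd (P := fun z => z ∈ S ∧ m < K * z)
    ⟨0, fun z hz => hS z hz.1⟩ (by
      obtain ⟨s, hs, hms⟩ := hub (max m 0)
      exact ⟨s, hs, by nlinarith [le_max_left m 0, le_max_right m 0]⟩)
  have hs₀l := hlmax s₀ ⟨hs₀, hm⟩
  lift l to ℕ using hS l hlS
  lift l' to ℕ using hS l' hlS'
  have hll' : (l : ℤ) < l' := by nlinarith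
  have hsame : S ∩ Set.Icc 1 ((l' - 1 : ℕ) : ℤ) = S ∩ Set.Icc 1 (l : ℤ) := by
    ext x
    simp only [Set.mem_inter_iff, Set.mem_Icc]
    refine and_congr_right fun hx => and_congr_right fun hx1 => ⟨fun hxl => ?_, fun hxl => by omega⟩
    by_contra hlt
    have hxm : m < K * x := by
      by_contra hcon
      exact hlt (hlmax x ⟨hx, not_lt.1 hcon⟩)
    have := hlmin x ⟨hx, hxm⟩
    omega
  have hl0 : 0 < l := by omega
  have : NeZero l := ⟨hl0.ne'⟩
  have hlC : (C : ℝ) < l := by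
    have : C < l := by omega
    exact_mod_cast this
  set n := (residues S l).card with hn
  have hnl : n ≤ l := by
    have := Finset.card_le_univ (residues S l)
    rwa [ZMod.card] at this
  have hnβ : β * ((l' : ℝ) - 1) ≤ n := by
    have := hN₀ (l' - 1) (by omega)
    rw [hsame, ← card_residues, Nat.cast_sub (by omega)] at this
    simpa using this
  have hres0 : (0 : ZMod l) ∈ residues S l :=
    mem_residues.2 ⟨l, hlS, by omega, le_rfl, by simp⟩
  have hn0 : 0 < n := Finset.card_pos.2 ⟨0, hres0⟩
  have hgen : AddSubgroup.closure (residues S l : Set (ZMod l)) = ⊤ :=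
    closure_residues_eq_top hS (y := max N₁ 0) (hN₁ _ (le_max_left _ _))
      (hN₁ _ (by omega)) (by omega)
  -- the least `r` with `2 * l ≤ (r + 1) * n`
  obtain ⟨r, hr1, hrn, hrn'⟩ : ∃ r : ℕ, 1 ≤ r ∧ 2 * l ≤ (r + 1) * n ∧ r * n < 2 * l := by
    refine ⟨(2 * l - 1) / n, (Nat.one_le_div_iff hn0).2 (by omega), ?_, ?_⟩
    · have := Nat.lt_div_mul_add (a := 2 * l - 1) hn0
      rw [add_mul]
      omega
    · have := Nat.div_mul_le_self (2 * l - 1) n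
      omega
  have hr : ∀ x : ZMod l, x ∈ r • residues S l := by
    have := nsmul_eq_univ_of_card_le hres0 hgen hr1 (by rwa [ZMod.card])
    exact Finset.eq_univ_iff_forall.1 this
  have hgapR : (r : ℝ) * l' ≤ (K + 1) * l := by
    have hr0 : (0 : ℝ) ≤ r := Nat.cast_nonneg r
    have hll : (l : ℝ) + 1 ≤ l' := by exact_mod_cast hll'
    have hrnR : (r : ℝ) * n < 2 * l := by exact_mod_cast hrn'
    have h1 : r * (β * ((l' : ℝ) - 1)) < 2 * l :=
      (mul_le_mul_of_nonneg_left hnβ hr0).trans_lt hrnR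
    have h2 : β * r < 2 := by
      have hl0R : (0 : ℝ) < l := by exact_mod_cast hl0
      nlinarith
    have h3 : 2 < l * (β * (K + 1) - 2) := by
      rw [← div_lt_iff₀ (by linarith)]
      exact hC.trans hlC
    have h4 : β * (r * l') ≤ β * ((K + 1) * l) := by linarith
    exact le_of_mul_le_mul_left h4 hβ
  have hrK : r ≤ K := by
    have h1 : (r : ℝ) * l < (K + 1) * l := by
      refine lt_of_lt_of_le ?_ hgapR
      have : (l : ℝ) < l' := by exact_mod_cast hll'
      have : (1 : ℝ) ≤ r := by exact_mod_cast hr1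
      nlinarith
    have h2 : (r : ℝ) < (K + 1 : ℕ) := by
      push_cast
      exact lt_of_mul_lt_mul_right h1 (Nat.cast_nonneg _)
    have h3 : r < K + 1 := by exact_mod_cast h2
    omega
  exact mem_nfold_of_scales h0 hlS hl0 hlS' hll' hr hr1 hrK (by exact_mod_cast hgapR) hlm hlm'

theorem exists_least_mem {S : Set ℤ} (hfin : (S ∩ {x | x < 0}).Finite) (hne : S.Nonempty) :
    ∃ c ∈ S, ∀ x ∈ S, c ≤ x := by
  obtain ⟨b, hb⟩ := hfin.bddBelow
  refine Int.exists_least_of_bdd (P := fun z => z ∈ S) ⟨min b 0, fun z hz => ?_⟩ hne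
  rcases lt_or_ge z 0 with h | h
  · exact (min_le_left _ _).trans (hb ⟨hz, h⟩)
  · exact (min_le_right _ _).trans h

theorem eventually_le_ncard_of_lt_lowerDensity {S : Set ℤ} {β : ℝ} (h : β < lowerDensity S) :
    ∀ᶠ n : ℕ in atTop, β * n ≤ (S ∩ Set.Icc 1 (n : ℤ)).ncard := by
  have hbdd : IsBoundedUnder (· ≥ ·) atTop
      (fun n : ℕ => ((S ∩ Set.Icc 1 (n : ℤ)).ncard : ℝ) / n) :=
    isBoundedUnder_of ⟨0, fun n => by positivity⟩
  filter_upwards [eventually_lt_of_lt_liminf h hbdd, eventually_gt_atTop 0] with n hn hn0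
  rw [lt_div_iff₀ (by exact_mod_cast hn0)] at hn
  exact hn.le

/-- Translating a set by `c` changes its counting function by at most `|c|`. -/
theorem ncard_inter_Icc_le_add {S T : Set ℤ} {c : ℤ} (h : ∀ x ∈ S, x - c ∈ T) (n : ℕ) :
    (S ∩ Set.Icc 1 (n : ℤ)).ncard ≤ (T ∩ Set.Icc 1 (n : ℤ)).ncard + c.natAbs := by
  classical
  have hfin : (T ∩ Set.Icc 1 (n : ℤ)).Finite := (Set.finite_Icc _ _).inter_of_right _
  have hsub : (fun x => x - c) '' (S ∩ Set.Icc 1 (n : ℤ)) ⊆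
      (T ∩ Set.Icc 1 (n : ℤ)) ∪ (Set.Ioc (-c) 0 ∪ Set.Ioc (n : ℤ) (n - c)) := by
    rintro _ ⟨x, ⟨hx, hx1, hxn⟩, rfl⟩
    have := h x hx
    simp only [Set.mem_union, Set.mem_inter_iff, Set.mem_Icc, Set.mem_Ioc, this, true_and]
    omega
  have hcard := Set.ncard_le_ncard hsub
    (hfin.union ((Set.finite_Ioc _ _).union (Set.finite_Ioc _ _)))
  rw [Set.ncard_image_of_injective _ (sub_left_injective)] at hcard
  refine hcard.trans ((Set.ncard_union_le _ _).trans (Nat.add_le_add_left ?_ _))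
  refine (Set.ncard_union_le _ _).trans ?_
  rw [← Finset.coe_Ioc, ← Finset.coe_Ioc, Set.ncard_coe_finset, Set.ncard_coe_finset,
    Int.card_Ioc, Int.card_Ioc]
  omega

theorem stmt2 (S : Set ℤ) (hfin : (S ∩ {x | x < 0}).Finite)
    (hα : 0 < lowerDensity S) (hbasis : IsAsympBasis S) :
    (basisOrder S : ℝ) ≤ 4 / lowerDensity S := by
  set α := lowerDensity S with hαdef
  have hne : S.Nonempty := by
    rw [Set.nonempty_iff_ne_empty]
    rintro rfl
    simp [hαdef, lowerDensity] at hα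
  obtain ⟨c, hc, hcmin⟩ := exists_least_mem hfin hne
  set K := ⌊2 / α⌋₊ with hK
  have hKα : (K : ℝ) ≤ 2 / α := Nat.floor_le (by positivity)
  have hK1 : 2 / (K + 1 : ℝ) < α := by
    have := Nat.lt_floor_add_one (2 / α)
    rw [div_lt_iff₀ hα] at this
    rw [div_lt_iff₀ (by positivity)]
    linarith
  obtain ⟨β, hβ, hβα⟩ := exists_between hK1
  obtain ⟨β', hββ', hβ'α⟩ := exists_between hβα
  have hβ0 : 0 < β := lt_trans (by positivity) hβ
  let T : Set ℤ := {x | x + c ∈ S}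
  have hST : ∀ x ∈ S, x - c ∈ T := fun x hx => by
    change x - c + c ∈ S
    simpa using hx
  have hcount : ∀ᶠ n : ℕ in atTop, β * n ≤ (T ∩ Set.Icc 1 (n : ℤ)).ncard := by
    have hlarge : ∀ᶠ n : ℕ in atTop, (c.natAbs : ℝ) / (β' - β) ≤ n :=
      tendsto_natCast_atTop_atTop.eventually_ge_atTop _
    filter_upwards [eventually_le_ncard_of_lt_lowerDensity hβ'α, hlarge] with n hn hn'
    have h1 : ((S ∩ Set.Icc 1 (n : ℤ)).ncard : ℝ) ≤
        (T ∩ Set.Icc 1 (n : ℤ)).ncard + c.natAbs := by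
      exact_mod_cast ncard_inter_Icc_le_add hST n
    rw [div_le_iff₀ (by linarith)] at hn'
    linarith
  have hTbasis : IsAsympBasis T := by
    obtain ⟨h, hh⟩ := hbasis
    exact ⟨h, hh.translate (c := -c) hST⟩
  have hT : CoversAt T (2 * K) := by
    refine coversAt_two_mul (by simpa [T] using hc) (fun x hx => ?_) hTbasis hβ0 ?_ hcount
    · have := hcmin _ hx
      omega
    · rwa [div_lt_iff₀ (by positivity)] at hβ
  have hle : basisOrder S ≤ 2 * K := Nat.sInf_le (hT.translate fun x hx => hx)
  calc (basisOrder S : ℝ) ≤ (2 * K : ℕ) := by exact_mod_cast hle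
    _ ≤ 2 * (2 / α) := by push_cast; linarith
    _ = 4 / α := by ring
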